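/- Let n ≥ 2 be even, V > 0, C > 0, λ > 0, and a₀, …, a_{n/2−1} real numbers. Let K : (0, ∞) → ℝ be continuous with |K(t) − (4πt)^{−n/2} Σ_{k=0}^{n/2−1} a_k t^k| ≤ C for all t ∈ (0, 1] and |K(t) − 1/V| ≤ C e^{−λt} for all t ≥ 1. Set D(t) = K(t) − 1/V − (4π)^{−n/2} Σ_{k=0}^{n/2−1} a_k t^{k−n/2}; for real s ∈ (0, n/2) with s ∉ {n/2 − k : 0 ≤ k ≤ n/2 − 1} define ζ(s) = (1/Γ(s)) [ Σ_{k=0}^{n/2−1} a_k / ((4π)^{n/2}(s − n/2 + k)) + ∫₁^∞ (K(t) − 1/V) t^{s−1} dt + ∫₀^1 D(t) t^{s−1} dt ]; and let R = lim_{ε→0⁺} { ∫_ε^∞ (K(t) − 1/V) dt − (4π)^{−n/2} [ Σ_{k=0}^{n/2−2} a_k ε^{k+1−n/2}/(n/2 − k − 1) − a_{n/2−1}(log(4ε) − γ) ] }, where γ is the Euler–Mascheroni constant. Then R = lim_{s→1⁺} [ ζ(s) − a_{n/2−1}/((4π)^{n/2}(s−1)) ] + a_{n/2−1}(log 4 −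 2γ)/(4π)^{n/2}, and in particular this limit exists. -/

import Mathlib

open Real MeasureTheory Filter

lemma robin_aux_gamma :
    Tendsto (fun s : ℝ => (1 / Real.Gamma s - 1) / (s - 1)) (nhdsWithin 1 (Set.Ioi 1))
      (nhds Real.eulerMascheroniConstant) := by
  have h := (Real.hasDerivAt_Gamma_one.fun_inv (by simp)).tendsto_slope.mono_left
    (nhdsGT_le_nhdsNE (1:ℝ))
  simp only [Real.Gamma_one, slope_fun_def_field] at h
  simpa using h

lemma robin_aux_pow (p k : ℕ) (hk : k < p) (ε : ℝ) (hε : 0 < ε) :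
    ∫ t in ε..1, t ^ ((k:ℝ) - (p + 1)) = 1 / ((k:ℝ) - p) + ε ^ ((k:ℝ) + 1 - (p + 1)) / ((p:ℝ) + 1 - k - 1) := by
  have hk' : (k:ℝ) < p := by exact_mod_cast hk
  have e : (k:ℝ) - (p + 1) + 1 = k - p := by ring
  have e2 : (k:ℝ) + 1 - (p + 1) = k - p := by ring
  have e3 : (p:ℝ) + 1 - k - 1 = -(k - p) := by ring
  rw [integral_rpow (Or.inr ⟨by linarith, Set.notMem_uIcc_of_lt hε one_pos⟩), e, e2, e3]
  rw [Real.one_rpow, div_neg]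
  ring

lemma robin_aux_log (p : ℕ) (ε : ℝ) (hε : 0 < ε) :
    ∫ t in ε..1, t ^ ((p:ℝ) - (p + 1)) = - Real.log ε := by
  have e : (p:ℝ) - (p + 1) = -1 := by ring
  simp only [e, Real.rpow_neg_one]
  rw [integral_inv_of_pos hε one_pos]
  simp

/-- Even-dimensional case of the theorem expressing the Robin function in terms
of the analytic extension of the Minakshisundaram–Pleijel zeta function:
if `R` is the regularized value of `∫_ε^∞ (K − 1/V) dt` (the Robin function
value), and `ζ` is the analytic continuation of the diagonal zeta function,
then `lim_{s→1⁺} [ζ(s) − a_{n/2−1}/((4π)^{n/2}(s−1))]` exists and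
`R = lim_{s→1⁺} [ζ(s) − a_{n/2−1}/((4π)^{n/2}(s−1))] + a_{n/2−1}(log 4 − 2γ)/(4π)^{n/2}`. -/
theorem robin_eq_zeta_regularized_even
    (n : ℕ) (hn : 2 ≤ n) (hne : Even n)
    (V C lam : ℝ) (hV : 0 < V) (hC : 0 < C) (hlam : 0 < lam)
    (a : ℕ → ℝ)
    (K : ℝ → ℝ) (hK : ContinuousOn K (Set.Ioi 0))
    (h1 : ∀ t ∈ Set.Ioc (0:ℝ) 1,
      |K t - (4 * π * t) ^ (-(n:ℝ) / 2) * ∑ k ∈ Finset.range (n / 2), a k * t ^ k| ≤ C)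
    (h2 : ∀ t : ℝ, 1 ≤ t → |K t - 1 / V| ≤ C * Real.exp (-lam * t))
    (D : ℝ → ℝ)
    (hD : ∀ t, D t = K t - 1 / V
      - (4 * π) ^ (-(n:ℝ) / 2) * ∑ k ∈ Finset.range (n / 2), a k * t ^ ((k:ℝ) - n / 2))
    (zeta : ℝ → ℝ)
    (hzeta : ∀ s : ℝ, 0 < s →
      (∀ k ∈ Finset.range (n / 2), s ≠ (n:ℝ) / 2 - k) →
      zeta s = (1 / Real.Gamma s) *
        ((∑ k ∈ Finset.range (n / 2),
            a k / ((4 * π) ^ ((n:ℝ) / 2) * (s - (n:ℝ) / 2 + k)))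
          + (∫ t in Set.Ioi (1:ℝ), (K t - 1 / V) * t ^ (s - 1))
          + ∫ t in Set.Ioc (0:ℝ) 1, D t * t ^ (s - 1)))
    (R : ℝ)
    (hR : Tendsto (fun ε : ℝ =>
        (∫ t in Set.Ioi ε, (K t - 1 / V))
          - (4 * π) ^ (-(n:ℝ) / 2) *
              ((∑ k ∈ Finset.range (n / 2 - 1),
                  a k * ε ^ ((k:ℝ) + 1 - n / 2) / ((n:ℝ) / 2 - k - 1))
                - a (n / 2 - 1) * (Real.log (4 * ε) - Real.eulerMascheroniConstant)))
      (nhdsWithin 0 (Set.Ioi 0)) (nhds R)) :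
    Tendsto (fun s : ℝ =>
        zeta s - a (n / 2 - 1) / ((4 * π) ^ ((n:ℝ) / 2) * (s - 1)))
      (nhdsWithin 1 (Set.Ioi 1))
      (nhds (R - a (n / 2 - 1) * (Real.log 4 - 2 * Real.eulerMascheroniConstant)
        / (4 * π) ^ ((n:ℝ) / 2))) := by
  obtain ⟨p, rfl⟩ : ∃ p, n = 2 * (p + 1) := by
    obtain ⟨m, rfl⟩ := hne
    exact ⟨m - 1, by omega⟩
  have en : 2 * (p + 1) / 2 = p + 1 := by omega
  have er : ((2 * (p + 1) : ℕ) : ℝ) / 2 = (p:ℝ) + 1 := by push_cast; ring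
  have er' : -((2 * (p + 1) : ℕ) : ℝ) / 2 = -((p:ℝ) + 1) := by push_cast; ring
  have ep : (4 * π) ^ ((p:ℝ) + 1) = ((4 * π) ^ (-((p:ℝ) + 1)))⁻¹ := by
    rw [Real.rpow_neg (by positivity), inv_inv]
  simp only [en, er, er', ep, Nat.add_sub_cancel] at *
  have hc : (4 * π) ^ (-((p:ℝ) + 1)) ≠ 0 := by positivity
  have hcm : ∀ t : ℝ, 0 < t → (4 * π * t) ^ (-((p:ℝ) + 1))
      = (4 * π) ^ (-((p:ℝ) + 1)) * t ^ (-((p:ℝ) + 1)) := fun t ht =>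
    Real.mul_rpow (by positivity) ht.le
  generalize (4 * π) ^ (-((p:ℝ) + 1)) = c at *
  -- continuity
  have hPc : ∀ k : ℕ, ContinuousOn (fun t : ℝ => t ^ ((k:ℝ) - (p + 1))) (Set.Ioi 0) := fun k =>
    continuousOn_id.rpow_const (fun t ht => Or.inl (ne_of_gt ht))
  have hKc : ContinuousOn (fun t => K t - 1 / V) (Set.Ioi 0) := hK.sub continuousOn_const
  have hDe : D = fun t => K t - 1 / V
      - c * ∑ k ∈ Finset.range (p + 1), a k * t ^ ((k:ℝ) - (p + 1)) := funext hD
  have hDc : ContinuousOn D (Set.Ioi 0) := by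
    rw [hDe]
    exact hKc.sub (continuousOn_const.mul (continuousOn_finsetSum _
      fun k _ => continuousOn_const.mul (hPc k)))
  -- boundedness of D
  have hDb : ∀ t ∈ Set.Ioc (0:ℝ) 1, |D t| ≤ C + 1 / V := by
    intro t ht
    have := h1 t ht
    have e : (4 * π * t) ^ (-((p:ℝ) + 1)) * ∑ k ∈ Finset.range (p + 1), a k * t ^ k
        = c * ∑ k ∈ Finset.range (p + 1), a k * t ^ ((k:ℝ) - (p + 1)) := by
      rw [hcm t ht.1, mul_assoc, Finset.mul_sum]
      congr 1
      refine Finset.sum_congr rfl fun k _ => ?_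
      rw [sub_eq_add_neg, Real.rpow_add ht.1, Real.rpow_natCast]
      ring
    rw [e] at this
    rw [hD t]
    have hV' : 0 < 1 / V := by positivity
    rw [abs_le] at this ⊢
    constructor <;> linarith [this.1, this.2]
  have hDi : IntegrableOn D (Set.Ioc 0 1) := by
    refine Integrable.mono' (g := fun _ => C + 1 / V) (integrableOn_const (by simp))
      ((hDc.mono Set.Ioc_subset_Ioi_self).aestronglyMeasurable measurableSet_Ioc) ?_
    filter_upwards [ae_restrict_mem measurableSet_Ioc] with t ht using hDb t ht
  have hbi : IntegrableOn (fun t : ℝ => C * (t * Real.exp (-lam * t))) (Set.Ioi 1) := by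
    have := integrableOn_rpow_mul_exp_neg_mul_rpow (s := 1) (p := 1) (by norm_num) one_pos hlam
    simp only [Real.rpow_one] at this
    exact (this.mono_set (Set.Ioi_subset_Ioi zero_le_one)).const_mul C
  have hsub : Set.Ioi (1:ℝ) ⊆ Set.Ioi 0 := Set.Ioi_subset_Ioi zero_le_one
  have hKi : IntegrableOn (fun t => K t - 1 / V) (Set.Ioi 1) := by
    refine Integrable.mono' hbi ((hKc.mono hsub).aestronglyMeasurable measurableSet_Ioi) ?_
    filter_upwards [ae_restrict_mem measurableSet_Ioi] with t ht
    have ht : 1 < t := ht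
    refine (h2 t ht.le).trans ?_
    have := Real.exp_pos (-lam * t)
    gcongr
    nlinarith
  -- dominated convergence
  have hev : ∀ᶠ s : ℝ in nhdsWithin 1 (Set.Ioi 1), s ∈ Set.Ioo (1:ℝ) 2 :=
    Ioo_mem_nhdsGT one_lt_two
  have hlim : ∀ (b t : ℝ), 0 < t → Tendsto (fun s : ℝ => b * t ^ (s - 1))
      (nhdsWithin 1 (Set.Ioi 1)) (nhds b) := by
    intro b t ht
    have : ContinuousAt (fun s : ℝ => b * t ^ (s - 1)) 1 :=
      continuousAt_const.mul (ContinuousAt.rpow continuousAt_const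
        (continuousAt_id.sub continuousAt_const) (Or.inl ht.ne'))
    have h := this.tendsto.mono_left (nhdsWithin_le_nhds (s := Set.Ioi 1))
    simpa using h
  have hsc : ∀ s : ℝ, ContinuousOn (fun t : ℝ => t ^ (s - 1)) (Set.Ioi 0) := fun s =>
    continuousOn_id.rpow_const (fun t ht => Or.inl (ne_of_gt ht))
  have hA : Tendsto (fun s : ℝ => ∫ t in Set.Ioi (1:ℝ), (K t - 1 / V) * t ^ (s - 1))
      (nhdsWithin 1 (Set.Ioi 1)) (nhds (∫ t in Set.Ioi (1:ℝ), (K t - 1 / V))) := by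
    refine tendsto_integral_filter_of_dominated_convergence _ ?_ ?_ hbi ?_
    · exact Eventually.of_forall fun s =>
        ((hKc.mul (hsc s)).mono hsub).aestronglyMeasurable measurableSet_Ioi
    · filter_upwards [hev] with s hs
      filter_upwards [ae_restrict_mem measurableSet_Ioi] with t ht
      have ht : 1 < t := ht
      have h3 : t ^ (s - 1) ≤ t := by
        calc t ^ (s - 1) ≤ t ^ (1:ℝ) :=
              Real.rpow_le_rpow_of_exponent_le ht.le (by linarith [hs.2])
          _ = t := Real.rpow_one t
      have h4 : 0 ≤ t ^ (s - 1) := by positivity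
      rw [norm_mul, Real.norm_eq_abs, Real.norm_eq_abs, abs_of_nonneg h4]
      calc |K t - 1 / V| * t ^ (s - 1) ≤ (C * Real.exp (-lam * t)) * t :=
            mul_le_mul (h2 t ht.le) h3 h4 (by positivity)
        _ = _ := by ring
    · filter_upwards [ae_restrict_mem measurableSet_Ioi] with t ht
      exact hlim _ t (hsub ht)
  have hB : Tendsto (fun s : ℝ => ∫ t in Set.Ioc (0:ℝ) 1, D t * t ^ (s - 1))
      (nhdsWithin 1 (Set.Ioi 1)) (nhds (∫ t in Set.Ioc (0:ℝ) 1, D t)) := by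
    refine tendsto_integral_filter_of_dominated_convergence (fun t => |D t|) ?_ ?_ hDi.abs ?_
    · exact Eventually.of_forall fun s =>
        ((hDc.mul (hsc s)).mono Set.Ioc_subset_Ioi_self).aestronglyMeasurable measurableSet_Ioc
    · filter_upwards [hev] with s hs
      filter_upwards [ae_restrict_mem measurableSet_Ioc] with t ht
      have h4 : 0 ≤ t ^ (s - 1) := Real.rpow_nonneg ht.1.le _
      rw [norm_mul, Real.norm_eq_abs, Real.norm_eq_abs, abs_of_nonneg h4]
      exact mul_le_of_le_one_right (abs_nonneg _)
        (Real.rpow_le_one ht.1.le ht.2 (by linarith [hs.1]))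
    · filter_upwards [ae_restrict_mem measurableSet_Ioc] with t ht
      exact hlim _ t ht.1
  -- the value of R
  have hBε : Tendsto (fun ε : ℝ => ∫ t in ε..1, D t) (nhdsWithin 0 (Set.Ioi 0))
      (nhds (∫ t in Set.Ioc (0:ℝ) 1, D t)) := by
    have h := intervalIntegral.continuousOn_primitive_interval_left (f := D) (a := 0) (b := 1)
      (μ := volume) (by rw [Set.uIcc_of_le zero_le_one, integrableOn_Icc_iff_integrableOn_Ioc]; exact hDi)
    have h0 := h 0 (by simp)
    rw [ContinuousWithinAt, Set.uIcc_of_le zero_le_one,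
      intervalIntegral.integral_of_le zero_le_one] at h0
    refine h0.mono_left ?_
    rw [← nhdsWithin_Ioo_eq_nhdsGT (zero_lt_one (α := ℝ))]
    exact nhdsWithin_mono _ Set.Ioo_subset_Icc_self
  set A := ∫ t in Set.Ioi (1:ℝ), (K t - 1 / V) with hAdef
  set B := ∫ t in Set.Ioc (0:ℝ) 1, D t with hBdef
  set S := ∑ k ∈ Finset.range p, a k / ((k:ℝ) - p) with hSdef
  have hRval : R = A + B + c * S + c * a p * (Real.log 4 - Real.eulerMascheroniConstant) := by
    refine tendsto_nhds_unique hR ?_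
    have h5 : Tendsto (fun ε : ℝ => A + (∫ t in ε..1, D t) + c * S
        + c * a p * (Real.log 4 - Real.eulerMascheroniConstant)) (nhdsWithin 0 (Set.Ioi 0))
        (nhds (A + B + c * S + c * a p * (Real.log 4 - Real.eulerMascheroniConstant))) :=
      ((hBε.const_add A).add_const _).add_const _
    refine h5.congr' ?_
    filter_upwards [Ioo_mem_nhdsGT (zero_lt_one (α := ℝ))] with ε hε
    have hsubI : Set.uIcc ε 1 ⊆ Set.Ioi 0 := by
      rw [Set.uIcc_of_le hε.2.le]
      intro t ht
      exact lt_of_lt_of_le hε.1 ht.1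
    have hPi : ∀ k : ℕ, IntervalIntegrable (fun t : ℝ => a k * t ^ ((k:ℝ) - (p + 1))) volume ε 1 :=
      fun k => (((hPc k).mono hsubI).intervalIntegrable).const_mul _
    have hDI : IntervalIntegrable D volume ε 1 := (hDc.mono hsubI).intervalIntegrable
    have hKI : IntervalIntegrable (fun t => K t - 1 / V) volume ε 1 :=
      (hKc.mono hsubI).intervalIntegrable
    have s1 : ∫ t in Set.Ioi ε, (K t - 1 / V) = (∫ t in ε..1, (K t - 1 / V)) + A := by
      rw [intervalIntegral.integral_of_le hε.2.le, hAdef, ← setIntegral_union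
        (Set.Ioc_disjoint_Ioi le_rfl) measurableSet_Ioi
        ((intervalIntegrable_iff_integrableOn_Ioc_of_le hε.2.le).1 hKI) hKi,
        Set.Ioc_union_Ioi_eq_Ioi hε.2.le]
    have s2 : ∫ t in ε..1, (K t - 1 / V) = (∫ t in ε..1, D t)
        + c * ∑ k ∈ Finset.range (p + 1), a k * ∫ t in ε..1, t ^ ((k:ℝ) - (p + 1)) := by
      have e : (fun t => K t - 1 / V) = fun t => D t
          + c * ∑ k ∈ Finset.range (p + 1), a k * t ^ ((k:ℝ) - (p + 1)) := by
        funext t; rw [hD t]; ring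
      rw [e, intervalIntegral.integral_add hDI, intervalIntegral.integral_const_mul,
        intervalIntegral.integral_finsetSum fun k _ => hPi k]
      · simp only [intervalIntegral.integral_const_mul]
      · have := (IntervalIntegrable.sum (Finset.range (p + 1)) fun k _ => hPi k).const_mul c
        refine this.congr ?_
        intro t _
        simp
    rw [s1, s2, Finset.sum_range_succ, robin_aux_log p ε hε.1,
      Finset.sum_congr rfl fun k hk => by
        rw [robin_aux_pow p k (Finset.mem_range.1 hk) ε hε.1, mul_add],
      Finset.sum_add_distrib, Real.log_mul (by norm_num) hε.1.ne']
    simp only [hSdef, mul_one_div, mul_div_assoc]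
    ring
  -- the limit of zeta
  have hS : Tendsto (fun s : ℝ => ∑ k ∈ Finset.range p, a k / (c⁻¹ * (s - ((p:ℝ) + 1) + k)))
      (nhdsWithin 1 (Set.Ioi 1)) (nhds (c * S)) := by
    rw [hSdef, Finset.mul_sum]
    refine tendsto_finsetSum _ fun k hk => ?_
    have hk' : (k:ℝ) < p := by exact_mod_cast Finset.mem_range.1 hk
    have hne : c⁻¹ * ((1:ℝ) - ((p:ℝ) + 1) + k) ≠ 0 :=
      mul_ne_zero (inv_ne_zero hc) (by intro h; linarith)
    have : ContinuousAt (fun s : ℝ => a k / (c⁻¹ * (s - ((p:ℝ) + 1) + k))) 1 :=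
      ContinuousAt.div (by fun_prop) (by fun_prop) hne
    have h := this.tendsto.mono_left (nhdsWithin_le_nhds (s := Set.Ioi 1))
    convert h using 2
    have e : (1:ℝ) - ((p:ℝ) + 1) + k = k - p := by ring
    rw [e]
    have : (k:ℝ) - p ≠ 0 := by intro h; linarith
    field_simp
  have hG : Tendsto (fun s : ℝ => 1 / Real.Gamma s) (nhdsWithin 1 (Set.Ioi 1)) (nhds 1) := by
    simp only [one_div]
    have h := ((Real.hasDerivAt_Gamma_one.continuousAt.inv₀ (by simp)).tendsto).mono_left
      (nhdsWithin_le_nhds (s := Set.Ioi 1))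
    rw [Pi.inv_apply, Real.Gamma_one, inv_one] at h
    exact h
  have hfin := (hG.mul ((hS.add hA).add hB)).add (robin_aux_gamma.const_mul (c * a p))
  have etarget : R - a p * (Real.log 4 - 2 * Real.eulerMascheroniConstant) / c⁻¹
      = 1 * (c * S + A + B) + c * a p * Real.eulerMascheroniConstant := by
    rw [hRval, div_inv_eq_mul]; ring
  rw [etarget]
  refine hfin.congr' ?_
  filter_upwards [hev] with s hs
  rw [hzeta s (by linarith [hs.1]) ?_, Finset.sum_range_succ]
  · have e : s - ((p:ℝ) + 1) + p = s - 1 := by ring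
    have h1s : s - 1 ≠ 0 := by linarith [hs.1]
    have h6 : a p / (c⁻¹ * (s - 1)) = c * a p / (s - 1) := by field_simp
    rw [e, h6]
    ring
  · intro k hk h
    have h7 : s = ((p + 1 - k : ℤ) : ℝ) := by rw [h]; push_cast; ring
    have h8 := hs.1
    have h9 := hs.2
    rw [h7] at h8 h9
    have h8 : (1:ℤ) < p + 1 - k := by exact_mod_cast h8
    have h9 : (p + 1 - k : ℤ) < 2 := by exact_mod_cast h9
    omega
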